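/- Let f ∈ W^{1,2}(B_{2σ}(x₀)), m ≥ 3, 0 < s ≤ σ, and suppose ⨍_{B_s(x₀)} f² ≤ (θ/4)·h² while ⨍_{B_{2σ}(x₀)} f² ≥ θ·h². If additionally (2^{−i}σ)^{2−m}∫_{B_{2^{1−i}σ}(x₀)}|Df|² ≤ c₀ (θ/σ^α) h² (2^{−i}σ)^α for every dyadic scale 2^{−i}σ ∈ [s, σ], then c₀ ≥ c(m,α) > 0. Equivalently, if c₀ is small enough (depending only on m, α, and the Morrey constant), there must exist a radius ϱ ∈ [s, 2σ] with ϱ^{2−m+... } weighted Dirichlet energy at least c₀(θ/σ^α)h²ϱ^{m−2+α}. -/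

import Mathlib

open MeasureTheory Metric

theorem MeasureTheory.eLpNorm_two_sq {X F : Type*} [MeasurableSpace X] [NormedAddCommGroup F]
    (g : X → F) (μ : Measure X) : eLpNorm g 2 μ ^ 2 = ∫⁻ x, ‖g x‖ₑ ^ 2 ∂μ := by
  simpa using eLpNorm_nnreal_pow_eq_lintegral (f := g) (μ := μ) (p := 2) two_ne_zero

theorem enorm_sub_sq_le_lintegral_enorm_deriv_sq {φ : ℝ → ℝ} (hφ : Differentiable ℝ φ) :
    ‖φ 2 - φ 1‖ₑ ^ 2 ≤ ∫⁻ t in Set.Ioc (1 : ℝ) 2, ‖deriv φ t‖ₑ ^ 2 := by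
  set ν : Measure ℝ := volume.restrict (Set.Ioc (1 : ℝ) 2) with hν
  have : IsProbabilityMeasure ν := ⟨by norm_num [hν]⟩
  have hmeas : AEStronglyMeasurable (deriv φ) ν := (measurable_deriv φ).aestronglyMeasurable
  rw [← eLpNorm_two_sq]
  gcongr
  by_cases htop : eLpNorm (deriv φ) 2 ν = ⊤
  · simp [htop]
  have hL2 : MemLp (deriv φ) 2 ν := ⟨hmeas, lt_top_iff_ne_top.2 htop⟩
  have hint : IntervalIntegrable (deriv φ) volume 1 2 :=
    (intervalIntegrable_iff_integrableOn_Ioc_of_le one_le_two).2 (hL2.integrable one_le_two)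
  calc ‖φ 2 - φ 1‖ₑ = ‖∫ t, deriv φ t ∂ν‖ₑ := by
        rw [← intervalIntegral.integral_eq_sub_of_hasDerivAt
          (fun t _ => (hφ t).hasDerivAt) hint, intervalIntegral.integral_of_le one_le_two]
    _ ≤ ∫⁻ t, ‖deriv φ t‖ₑ ∂ν := enorm_integral_le_lintegral_enorm _
    _ = eLpNorm (deriv φ) 1 ν := eLpNorm_one_eq_lintegral_enorm.symm
    _ ≤ eLpNorm (deriv φ) 2 ν := eLpNorm_le_eLpNorm_of_exponent_le one_le_two hmeas

section Dilation

variable {E : Type*} [NormedAddCommGroup E] [NormedSpace ℝ E] [MeasurableSpace E] [BorelSpace E]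
  [FiniteDimensional ℝ E] (μ : Measure E) [μ.IsAddHaarMeasure]

open Module (finrank)

theorem setLIntegral_unitBall_comp_add_smul {g : E → ENNReal} (hg : Measurable g) (x₀ : E)
    {r : ℝ} (hr : 0 < r) :
    ∫⁻ y in ball 0 1, g (x₀ + r • y) ∂μ =
      ENNReal.ofReal (r ^ finrank ℝ E)⁻¹ * ∫⁻ x in ball x₀ r, g x ∂μ := by
  have hmap : μ.map (fun y => x₀ + r • y) = ENNReal.ofReal (r ^ finrank ℝ E)⁻¹ • μ := by
    have := Measure.map_map (μ := μ) (measurable_const_add x₀) (measurable_const_smul r)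
    rw [show (fun y => x₀ + r • y) = (x₀ + ·) ∘ (r • ·) from rfl, ← this,
      Measure.map_addHaar_smul μ hr.ne', Measure.map_smul, map_add_left_eq_self,
      abs_of_pos (by positivity)]
  have hball : (fun y => x₀ + r • y) ⁻¹' ball x₀ r = ball 0 1 := by
    ext y
    simp [dist_eq_norm, norm_smul, abs_of_pos hr, hr]
  rw [← hball, ← setLIntegral_map measurableSet_ball hg (by fun_prop), hmap,
    Measure.restrict_smul, lintegral_smul_measure, smul_eq_mul]

theorem eLpNorm_unitBall_comp_add_smul {f : E → ℝ} (hf : Measurable f) {x₀ : E} {r : ℝ}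
    (hr : 0 < r) (hint : IntegrableOn (fun x => f x ^ 2) (ball x₀ r) μ) :
    eLpNorm (fun y => f (x₀ + r • y)) 2 (μ.restrict (ball 0 1)) =
      ENNReal.ofReal √((r ^ finrank ℝ E)⁻¹ * ∫ x in ball x₀ r, f x ^ 2 ∂μ) := by
  have hnn : 0 ≤ ∫ x in ball x₀ r, f x ^ 2 ∂μ := integral_nonneg fun x => sq_nonneg _
  rw [← ENNReal.pow_right_strictMono two_ne_zero |>.injective.eq_iff]
  rw [eLpNorm_two_sq, setLIntegral_unitBall_comp_add_smul μ (g := fun x => ‖f x‖ₑ ^ 2)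
    (by fun_prop) x₀ hr, ← ENNReal.ofReal_pow (Real.sqrt_nonneg _), Real.sq_sqrt (by positivity),
    ENNReal.ofReal_mul (by positivity),
    ofReal_integral_eq_lintegral_ofReal hint (.of_forall fun x => sq_nonneg _)]
  congr 1
  refine lintegral_congr fun x => ?_
  rw [← ofReal_norm, ← ENNReal.ofReal_pow (norm_nonneg _), Real.norm_eq_abs, sq_abs]

theorem eLpNorm_dilation_sub_sq_le {f : E → ℝ} (hf : Differentiable ℝ f) (x₀ : E) {ρ : ℝ}
    (hρ : 0 < ρ) :
    eLpNorm (fun y => f (x₀ + (2 * ρ) • y) - f (x₀ + ρ • y)) 2 (μ.restrict (ball 0 1)) ^ 2 ≤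
      ENNReal.ofReal (ρ ^ 2 * (ρ ^ finrank ℝ E)⁻¹) *
        ∫⁻ x in ball x₀ (2 * ρ), ‖fderiv ℝ f x‖ₑ ^ 2 ∂μ := by
  have hmeas : Measurable (fderiv ℝ f) := measurable_fderiv ℝ f
  have hpt : ∀ y ∈ ball (0 : E) 1, ‖f (x₀ + (2 * ρ) • y) - f (x₀ + ρ • y)‖ₑ ^ 2 ≤
      ∫⁻ t in Set.Ioc (1 : ℝ) 2,
        ENNReal.ofReal (ρ ^ 2) * ‖fderiv ℝ f (x₀ + (t * ρ) • y)‖ₑ ^ 2 := by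
    intro y hy
    have hd : ∀ t : ℝ, HasDerivAt (fun t : ℝ => f (x₀ + (t * ρ) • y))
        (fderiv ℝ f (x₀ + (t * ρ) • y) (ρ • y)) t := fun t => by
      have h1 : HasDerivAt (fun t : ℝ => x₀ + (t * ρ) • y) (ρ • y) t := by
        simpa using (((hasDerivAt_id t).mul_const ρ).smul_const y).const_add x₀
      exact (hf _).hasFDerivAt.comp_hasDerivAt t h1
    have := enorm_sub_sq_le_lintegral_enorm_deriv_sq fun t => (hd t).differentiableAt
    rw [one_mul] at this
    refine this.trans (lintegral_mono fun t => ?_)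
    rw [(hd t).deriv, ← ofReal_norm, ← ofReal_norm,
      ← ENNReal.ofReal_pow (norm_nonneg _), ← ENNReal.ofReal_pow (norm_nonneg _),
      ← ENNReal.ofReal_mul (by positivity), ← mul_pow]
    gcongr
    refine (ContinuousLinearMap.le_opNorm _ _).trans ?_
    rw [mul_comm, norm_smul, Real.norm_of_nonneg hρ.le]
    gcongr
    exact mul_le_of_le_one_right hρ.le (mem_ball_zero_iff.1 hy).le
  rw [eLpNorm_two_sq]
  refine (setLIntegral_mono' measurableSet_ball hpt).trans ?_
  rw [lintegral_lintegral_swap (by fun_prop)]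
  have hslice : ∀ t ∈ Set.Ioc (1 : ℝ) 2,
      ∫⁻ y in ball 0 1, ENNReal.ofReal (ρ ^ 2) * ‖fderiv ℝ f (x₀ + (t * ρ) • y)‖ₑ ^ 2 ∂μ ≤
        ENNReal.ofReal (ρ ^ 2 * (ρ ^ finrank ℝ E)⁻¹) *
          ∫⁻ x in ball x₀ (2 * ρ), ‖fderiv ℝ f x‖ₑ ^ 2 ∂μ := by
    rintro t ⟨h1, h2⟩
    rw [lintegral_const_mul _ (by fun_prop), setLIntegral_unitBall_comp_add_smul μ
      (g := fun x => ‖fderiv ℝ f x‖ₑ ^ 2) (by fun_prop) x₀ (by positivity), ← mul_assoc,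
      ← ENNReal.ofReal_mul (by positivity)]
    gcongr
    exact le_mul_of_one_le_left hρ.le h1.le
  refine (setLIntegral_mono' measurableSet_Ioc hslice).trans_eq ?_
  norm_num

theorem sqrt_scaled_integral_sq_two_mul_le {f : E → ℝ} (hf : Differentiable ℝ f) {x₀ : E} {ρ : ℝ}
    (hρ : 0 < ρ) (hint : IntegrableOn (fun x => f x ^ 2) (ball x₀ (2 * ρ)) μ)
    (hint' : IntegrableOn (fun x => ‖fderiv ℝ f x‖ ^ 2) (ball x₀ (2 * ρ)) μ) :
    √(((2 * ρ) ^ finrank ℝ E)⁻¹ * ∫ x in ball x₀ (2 * ρ), f x ^ 2 ∂μ) ≤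
      √((ρ ^ finrank ℝ E)⁻¹ * ∫ x in ball x₀ ρ, f x ^ 2 ∂μ) +
        √(ρ ^ 2 * (ρ ^ finrank ℝ E)⁻¹ * ∫ x in ball x₀ (2 * ρ), ‖fderiv ℝ f x‖ ^ 2 ∂μ) := by
  have hfm : Measurable f := hf.continuous.measurable
  have hnn : 0 ≤ ∫ x in ball x₀ (2 * ρ), ‖fderiv ℝ f x‖ ^ 2 ∂μ :=
    integral_nonneg fun x => sq_nonneg _
  have hsub : eLpNorm (fun y => f (x₀ + (2 * ρ) • y) - f (x₀ + ρ • y)) 2 (μ.restrict (ball 0 1)) ≤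
      ENNReal.ofReal
        √(ρ ^ 2 * (ρ ^ finrank ℝ E)⁻¹ * ∫ x in ball x₀ (2 * ρ), ‖fderiv ℝ f x‖ ^ 2 ∂μ) := by
    rw [← ENNReal.pow_le_pow_left_iff two_ne_zero, ← ENNReal.ofReal_pow (Real.sqrt_nonneg _),
      Real.sq_sqrt (by positivity), ENNReal.ofReal_mul (by positivity),
      ofReal_integral_eq_lintegral_ofReal hint' (.of_forall fun x => sq_nonneg _)]
    simpa only [ENNReal.ofReal_pow (norm_nonneg _), ofReal_norm] using
      eLpNorm_dilation_sub_sq_le μ hf x₀ hρ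
  have htri := eLpNorm_add_le (μ := μ.restrict (ball 0 1)) (p := 2)
    (f := fun y => f (x₀ + ρ • y))
    (g := fun y => f (x₀ + (2 * ρ) • y) - f (x₀ + ρ • y))
    (Measurable.aestronglyMeasurable (by fun_prop))
    (Measurable.aestronglyMeasurable (by fun_prop)) one_le_two
  have hadd : ((fun y => f (x₀ + ρ • y)) + fun y => f (x₀ + (2 * ρ) • y) - f (x₀ + ρ • y)) =
      fun y => f (x₀ + (2 * ρ) • y) := by
    ext y
    simp
  have hle : ball x₀ ρ ⊆ ball x₀ (2 * ρ) := ball_subset_ball (by linarith)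
  rw [hadd, eLpNorm_unitBall_comp_add_smul μ hfm (by positivity) hint,
    eLpNorm_unitBall_comp_add_smul μ hfm hρ (hint.mono_set hle)] at htri
  have := htri.trans (add_le_add_right hsub _)
  rwa [← ENNReal.ofReal_add (Real.sqrt_nonneg _) (Real.sqrt_nonneg _),
    ENNReal.ofReal_le_ofReal_iff (by positivity)] at this

theorem setAverage_ball_eq (g : E → ℝ) (x₀ : E) {r : ℝ} (hr : 0 < r) :
    (⨍ x in ball x₀ r, g x ∂μ) =
      (μ.real (ball 0 1))⁻¹ * ((r ^ finrank ℝ E)⁻¹ * ∫ x in ball x₀ r, g x ∂μ) := by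
  rw [setAverage_eq, measureReal_def, Measure.addHaar_ball_of_pos μ x₀ hr, ENNReal.toReal_mul,
    ENNReal.toReal_ofReal (by positivity), ← measureReal_def, mul_inv, smul_eq_mul]
  ring

end Dilation

theorem le_add_of_dyadic_le {B : ℕ → ℝ} {K q : ℝ} (hK : 0 ≤ K) (hq0 : 0 ≤ q) (hq1 : q < 1)
    (j : ℕ) (h : ∀ i ≤ j, B i ≤ B (i + 1) + K * q ^ i) :
    B 0 ≤ B (j + 1) + K * (1 - q)⁻¹ := by
  have hsum : ∀ n ≤ j + 1, B 0 ≤ B n + K * ∑ i ∈ Finset.range n, q ^ i := by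
    intro n
    induction n with
    | zero => simp
    | succ n ih =>
      intro hn
      have h1 := ih (by omega)
      have h2 := h n (by omega)
      rw [Finset.sum_range_succ]
      linarith
  have hgeom : ∑ i ∈ Finset.range (j + 1), q ^ i ≤ (1 - q)⁻¹ := by
    rw [← tsum_geometric_of_lt_one hq0 hq1]
    exact (summable_geometric_of_lt_one hq0 hq1).sum_le_tsum _ fun i _ => by positivity
  have := mul_le_mul_of_nonneg_left hgeom hK
  linarith [hsum (j + 1) le_rfl]

/-- Dyadic summation argument: if `⨍_{B_s} f² ≤ (θ/4)h²`, `⨍_{B_{2σ}} f² ≥ θh²`,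
and the normalized Dirichlet energies at all dyadic scales `σ/2^i ∈ [s,σ]`
satisfy `(σ/2^i)^{2-m} ∫_{B_{2σ/2^i}} |Df|² ≤ c₀ (θ/σ^α) h² (σ/2^i)^α`, then
`c₀ ≥ c(m,α) > 0`. -/
theorem stmt_15 (m : ℕ) (α : ℝ) (hm : 3 ≤ m) (hα : 0 < α) :
    ∃ c : ℝ, 0 < c ∧
    ∀ (f : EuclideanSpace ℝ (Fin m) → ℝ)
      (f' : EuclideanSpace ℝ (Fin m) → (EuclideanSpace ℝ (Fin m) →L[ℝ] ℝ))
      (x₀ : EuclideanSpace ℝ (Fin m)) (σ s θ h c₀ : ℝ),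
      0 < s → s ≤ σ → (∃ j : ℕ, s = σ / 2 ^ j) →
      0 < θ → 0 < h → 0 ≤ c₀ →
      (∀ x, HasFDerivAt f (f' x) x) →
      IntegrableOn (fun x => (f x)^2) (ball x₀ (2*σ)) →
      IntegrableOn (fun x => ‖f' x‖^2) (ball x₀ (2*σ)) →
      (⨍ x in ball x₀ s, (f x)^2) ≤ (θ/4) * h^2 →
      θ * h^2 ≤ (⨍ x in ball x₀ (2*σ), (f x)^2) →
      (∀ i : ℕ, s ≤ σ / 2^i →
        (σ / 2^i) ^ ((2:ℝ) - m) * (∫ x in ball x₀ (2 * (σ / 2^i)), ‖f' x‖^2) ≤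
          c₀ * (θ / σ ^ α) * h^2 * (σ / 2^i) ^ α) →
      c ≤ c₀ := by
  set E := EuclideanSpace ℝ (Fin m)
  set ω : ℝ := (volume : Measure E).real (ball 0 1) with hω
  set q : ℝ := √((2 : ℝ) ^ (-α)) with hq
  have hωpos : 0 < ω :=
    ENNReal.toReal_pos (measure_ball_pos _ _ one_pos).ne' measure_ball_lt_top.ne
  have hq0 : 0 ≤ q := Real.sqrt_nonneg _
  have hq1 : q < 1 := by
    rw [hq, Real.sqrt_lt' one_pos, one_pow]
    exact Real.rpow_lt_one_of_one_lt_of_neg one_lt_two (by linarith)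
  refine ⟨ω * ((1 - q) / 2) ^ 2, mul_pos hωpos (pow_pos (by linarith) 2), ?_⟩
  rintro f f' x₀ σ s θ h c₀ hs hsσ ⟨j, rfl⟩ hθ hh hc₀ hf hint hint' hlow hhigh hdir
  obtain rfl : f' = fderiv ℝ f := funext fun x => (hf x).fderiv.symm
  have hfd : Differentiable ℝ f := fun x => (hf x).differentiableAt
  have hσ : 0 < σ := hs.trans_le hsσ
  have hfin : Module.finrank ℝ E = m := by simp [E]
  set b : ℝ → ℝ := fun r => (r ^ m)⁻¹ * ∫ x in ball x₀ r, f x ^ 2 with hb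
  set K : ℝ := √(c₀ * θ) * h with hK
  have hstep : ∀ i ≤ j, √(b (2 * (σ / 2 ^ i))) ≤ √(b (2 * (σ / 2 ^ (i + 1)))) + K * q ^ i := by
    intro i hi
    set ρ : ℝ := σ / 2 ^ i with hρdef
    have hρ : 0 < ρ := by positivity
    have hρσ : ρ ≤ σ := div_le_self hσ.le (one_le_pow₀ one_le_two)
    have hsub : ball x₀ (2 * ρ) ⊆ ball x₀ (2 * σ) := ball_subset_ball (by linarith)
    have key := sqrt_scaled_integral_sq_two_mul_le volume hfd hρ (hint.mono_set hsub)
      (hint'.mono_set hsub)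
    rw [hfin] at key
    have hnext : 2 * (σ / 2 ^ (i + 1)) = ρ := by
      rw [hρdef, pow_succ]
      field_simp
    rw [hnext]
    refine key.trans (add_le_add_right ?_ _)
    have henergy := hdir i (div_le_div_of_nonneg_left hσ.le (by positivity)
      (pow_le_pow_right₀ one_le_two hi))
    rw [Real.rpow_sub hρ, Real.rpow_natCast, Real.rpow_two] at henergy
    have hscale : c₀ * (θ / σ ^ α) * h ^ 2 * ρ ^ α = (K * q ^ i) ^ 2 := by
      have hqi : (q ^ i) ^ 2 = ((2 : ℝ) ^ i) ^ (-α) := by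
        rw [← pow_mul, mul_comm, pow_mul, hq, Real.sq_sqrt (by positivity), ← Real.rpow_natCast,
          ← Real.rpow_mul two_pos.le, mul_comm, Real.rpow_mul two_pos.le, Real.rpow_natCast]
      rw [mul_pow, hqi, hK, mul_pow, Real.sq_sqrt (by positivity), hρdef,
        Real.div_rpow hσ.le (by positivity), Real.rpow_neg (by positivity)]
      have := (Real.rpow_pos_of_pos hσ α).ne'
      field_simp
    rw [hscale, div_eq_mul_inv] at henergy
    exact Real.sqrt_le_iff.2 ⟨by positivity, henergy⟩
  have htel := le_add_of_dyadic_le (B := fun i => √(b (2 * (σ / 2 ^ i)))) (by positivity) hq0 hq1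
    j hstep
  have hend : 2 * (σ / 2 ^ (j + 1)) = σ / 2 ^ j := by
    rw [pow_succ]
    field_simp
  simp only [pow_zero, div_one, hend] at htel
  rw [setAverage_ball_eq volume _ x₀ hs, hfin, ← hω, inv_mul_le_iff₀ hωpos] at hlow
  rw [setAverage_ball_eq volume _ x₀ (by positivity), hfin, ← hω, le_inv_mul_iff₀ hωpos] at hhigh
  have hlow' : √(b (σ / 2 ^ j)) ≤ √(ω * θ) * h / 2 := by
    refine Real.sqrt_le_iff.2 ⟨by positivity, hlow.trans_eq ?_⟩
    rw [div_pow, mul_pow, Real.sq_sqrt (by positivity)]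
    ring
  have hhigh' : √(ω * θ) * h ≤ √(b (2 * σ)) := by
    refine Real.le_sqrt_of_sq_le (Eq.trans_le ?_ hhigh)
    rw [mul_pow, Real.sq_sqrt (by positivity)]
    ring
  have hmain : √(ω * θ) * h / 2 ≤ √(c₀ * θ) * h * (1 - q)⁻¹ := by linarith
  rw [Real.sqrt_mul hωpos.le, Real.sqrt_mul hc₀, ← div_eq_mul_inv,
    le_div_iff₀ (by linarith)] at hmain
  have hroot : √ω * ((1 - q) / 2) ≤ √c₀ := by
    refine le_of_mul_le_mul_right ?_ (mul_pos (Real.sqrt_pos.2 hθ) hh)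
    linarith
  calc ω * ((1 - q) / 2) ^ 2 = (√ω * ((1 - q) / 2)) ^ 2 := by
        rw [mul_pow, Real.sq_sqrt hωpos.le]
    _ ≤ √c₀ ^ 2 := pow_le_pow_left₀ (mul_nonneg (Real.sqrt_nonneg _) (by linarith)) hroot 2
    _ = c₀ := Real.sq_sqrt hc₀
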